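/- Let α > 0. For every x ∈ ℚ_p⁴ one has |f°(x)|_p^α = ((1 − p^α)/(1 − p^{−α−2})) · ∫_{ℚ_p⁴} |f(ξ)|_p^{−α−2} (χ(ξ·x) − 1) d⁴ξ, the integral being absolutely convergent (for x ≠ 0 the integrand vanishes for ‖ξ‖_p small, and it is O(‖ξ‖_p^{−2α−4}) at infinity). -/

import Mathlib

open MeasureTheory Real Filter Set

noncomputable section

namespace PadicParabolic

variable (p : ℕ) [Fact p.Prime]

instance : MeasurableSpace ℚ_[p] := borel _
instance : BorelSpace ℚ_[p] := ⟨rfl⟩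

/-- The four dimensional vector space over `ℚ_[p]`, with the max-norm
`‖x‖ = max_{1 ≤ i ≤ 4} |x_i|_p`. -/
abbrev V (p : ℕ) [Fact p.Prime] := Fin 4 → ℚ_[p]

/-- `a` is a quadratic non-residue modulo `p`. -/
def IsQNR (a : ℤ) : Prop := ∀ b : ZMod p, b ^ 2 ≠ (a : ZMod p)

/-- The elliptic quadratic form `f(x) = x₁² − a x₂² − p x₃² + a p x₄²`. -/
def qf (a : ℤ) (x : V p) : ℚ_[p] :=
  x 0 ^ 2 - (a : ℚ_[p]) * x 1 ^ 2 - (p : ℚ_[p]) * x 2 ^ 2 + (a : ℚ_[p]) * (p : ℚ_[p]) * x 3 ^ 2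

/-- The dual elliptic quadratic form `f°(ξ) = a p ξ₁² − p ξ₂² − a ξ₃² + ξ₄²`. -/
def qfc (a : ℤ) (x : V p) : ℚ_[p] :=
  (a : ℚ_[p]) * (p : ℚ_[p]) * x 0 ^ 2 - (p : ℚ_[p]) * x 1 ^ 2 - (a : ℚ_[p]) * x 2 ^ 2 + x 3 ^ 2

/-- `χ` is the standard additive character `χ(y) = exp(2πi {y}_p)` of `ℚ_p`, characterized as
the unique continuous function with `χ(m/pⁿ) = exp(2πi m/pⁿ)`. -/
def IsStdChar (χ : ℚ_[p] → ℂ) : Prop :=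
  Continuous χ ∧ ∀ (m : ℤ) (n : ℕ),
    χ ((m : ℚ_[p]) / (p : ℚ_[p]) ^ n) =
      Complex.exp (2 * (Real.pi : ℂ) * Complex.I * (m : ℂ) / (p : ℂ) ^ n)

section

variable {p}

theorem IsStdChar.apply_padicInt {χ : ℚ_[p] → ℂ} (hχ : IsStdChar p χ) (u : ℤ_[p]) : χ u = 1 := by
  have hc := hχ.1
  induction u using PadicInt.denseRange_intCast.induction_on with
  | hp => exact isClosed_eq (hc.comp continuous_subtype_val) continuous_const
  | ih m =>
    have h := hχ.2 m 0
    simp only [pow_zero, div_one] at h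
    rw [PadicInt.coe_intCast, h, Complex.exp_eq_one_iff]
    exact ⟨m, by ring⟩

theorem IsStdChar.apply_of_norm_le_one {χ : ℚ_[p] → ℂ} (hχ : IsStdChar p χ) {y : ℚ_[p]}
    (hy : ‖y‖ ≤ 1) : χ y = 1 :=
  hχ.apply_padicInt ⟨y, hy⟩

theorem exists_eq_padicInt_div_pow (x y : ℚ_[p]) :
    ∃ (u v : ℤ_[p]) (n : ℕ), x = u / (p : ℚ_[p]) ^ n ∧ y = v / (p : ℚ_[p]) ^ n := by
  have hp : 1 < (p : ℝ) := by exact_mod_cast (Fact.out : p.Prime).one_lt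
  have hp0 : (p : ℚ_[p]) ≠ 0 := by exact_mod_cast (Fact.out : p.Prime).ne_zero
  obtain ⟨n, hn⟩ := pow_unbounded_of_one_lt (max ‖x‖ ‖y‖) hp
  have key : ∀ z : ℚ_[p], ‖z‖ < (p : ℝ) ^ n → ‖z * (p : ℚ_[p]) ^ n‖ ≤ 1 := by
    intro z hz
    rw [norm_mul, norm_pow, Padic.norm_p, inv_pow, ← div_eq_mul_inv]
    exact (div_le_one (by positivity)).2 hz.le
  refine ⟨⟨_, key x ((le_max_left _ _).trans_lt hn)⟩,
    ⟨_, key y ((le_max_right _ _).trans_lt hn)⟩, n, ?_, ?_⟩ <;> field_simp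

theorem IsStdChar.apply_add {χ : ℚ_[p] → ℂ} (hχ : IsStdChar p χ) (x y : ℚ_[p]) :
    χ (x + y) = χ x * χ y := by
  have hc := hχ.1
  obtain ⟨u, v, n, rfl, rfl⟩ := exists_eq_padicInt_div_pow x y
  induction u, v using PadicInt.denseRange_intCast.induction_on₂ with
  | hp =>
    have := continuous_subtype_val (p := fun x : ℚ_[p] => ‖x‖ ≤ 1)
    exact isClosed_eq (by fun_prop) (by fun_prop)
  | h m k =>
    rw [PadicInt.coe_intCast, PadicInt.coe_intCast, ← add_div, ← Int.cast_add, hχ.2, hχ.2, hχ.2,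
      ← Complex.exp_add]
    push_cast
    ring_nf

theorem IsStdChar.norm_apply {χ : ℚ_[p] → ℂ} (hχ : IsStdChar p χ) (x : ℚ_[p]) : ‖χ x‖ = 1 := by
  have hc := hχ.1
  obtain ⟨u, -, n, rfl, -⟩ := exists_eq_padicInt_div_pow x 0
  induction u using PadicInt.denseRange_intCast.induction_on with
  | hp =>
    have := continuous_subtype_val (p := fun x : ℚ_[p] => ‖x‖ ≤ 1)
    exact isClosed_eq (by fun_prop) continuous_const
  | ih m =>
    rw [PadicInt.coe_intCast, hχ.2,
      show 2 * (Real.pi : ℂ) * Complex.I * (m : ℂ) / (p : ℂ) ^ n =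
        ((2 * Real.pi * m / p ^ n : ℝ) : ℂ) * Complex.I by push_cast; ring,
      Complex.norm_exp_ofReal_mul_I]

theorem IsStdChar.apply_inv_p_ne_one {χ : ℚ_[p] → ℂ} (hχ : IsStdChar p χ) :
    χ ((p : ℚ_[p])⁻¹) ≠ 1 := by
  have h := hχ.2 1 1
  have hp := (Fact.out : p.Prime)
  rw [Int.cast_one, pow_one, one_div] at h
  rw [h]
  have := (Complex.isPrimitiveRoot_exp p hp.ne_zero).ne_one hp.one_lt
  simpa using this

theorem IsQNR.norm_intCast {a : ℤ} (ha : IsQNR p a) : ‖(a : ℚ_[p])‖ = 1 := by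
  refine (Padic.norm_int_le_one a).eq_of_not_lt fun h => ha 0 ?_
  rw [Padic.norm_intCast_lt_one_iff] at h
  rw [(ZMod.intCast_zmod_eq_zero_iff_dvd a p).2 h]
  simp

theorem IsQNR.norm_sq_sub {a : ℤ} (ha : IsQNR p a) {b : ℚ_[p]} (hb : ‖b‖ ≤ 1) :
    ‖b ^ 2 - a‖ = 1 := by
  obtain ⟨b, rfl⟩ : ∃ c : ℤ_[p], (c : ℚ_[p]) = b := ⟨⟨b, hb⟩, rfl⟩
  have : ‖b ^ 2 - (a : ℤ_[p])‖ = 1 := by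
    refine (PadicInt.norm_le_one _).eq_of_not_lt fun h => ha (PadicInt.toZMod b) ?_
    have h1 : b ^ 2 - (a : ℤ_[p]) ∈ RingHom.ker (PadicInt.toZMod : ℤ_[p] →+* ZMod p) := by
      rw [PadicInt.ker_toZMod, PadicInt.maximalIdeal_eq_span_p, Ideal.mem_span_singleton]
      exact PadicInt.norm_lt_one_iff_dvd _ |>.1 h
    rw [RingHom.mem_ker, map_sub, map_pow, map_intCast, sub_eq_zero] at h1
    exact h1
  rw [PadicInt.norm_def] at this
  exact_mod_cast this

theorem IsQNR.norm_sq_sub_mul_sq {a : ℤ} (ha : IsQNR p a) (x y : ℚ_[p]) :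
    ‖x ^ 2 - a * y ^ 2‖ = max (‖x‖ ^ 2) (‖y‖ ^ 2) := by
  rcases lt_or_ge ‖y‖ ‖x‖ with h | h
  · have h2 : ‖y‖ ^ 2 < ‖x‖ ^ 2 := by gcongr
    rw [sub_eq_add_neg, Padic.add_eq_max_of_ne] <;>
      simp only [norm_neg, norm_mul, norm_pow, ha.norm_intCast, one_mul]
    exact h2.ne'
  · have h2 : ‖x‖ ^ 2 ≤ ‖y‖ ^ 2 := by gcongr
    rw [max_eq_right h2]
    rcases eq_or_ne y 0 with rfl | hy
    · have : x = 0 := by simpa using h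
      simp [this]
    · have := ha.norm_sq_sub (b := x / y)
        (by rw [norm_div]; exact div_le_one_of_le₀ h (norm_nonneg _))
      rw [show x ^ 2 - a * y ^ 2 = ((x / y) ^ 2 - a) * y ^ 2 by field_simp, norm_mul, this,
        norm_pow, one_mul]

theorem eq_zero_of_norm_sq_eq_inv_mul_norm_sq {u v : ℚ_[p]}
    (h : ‖u‖ ^ 2 = (p : ℝ)⁻¹ * ‖v‖ ^ 2) : v = 0 := by
  by_contra hv
  have hp := (Fact.out : p.Prime)
  have hp1 : 1 < (p : ℝ) := by exact_mod_cast hp.one_lt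
  have hu : u ≠ 0 := by
    rintro rfl
    have : 0 < (p : ℝ)⁻¹ * ‖v‖ ^ 2 := by positivity
    rw [← h, norm_zero] at this
    norm_num at this
  rw [Padic.norm_eq_zpow_neg_valuation hu, Padic.norm_eq_zpow_neg_valuation hv,
    ← zpow_natCast, ← zpow_natCast, ← zpow_mul, ← zpow_mul, ← zpow_neg_one,
    ← zpow_add₀ (by positivity)] at h
  have := zpow_right_injective₀ (by positivity) hp1.ne' h
  push_cast at this
  omega

theorem IsQNR.norm_qf {a : ℤ} (ha : IsQNR p a) (x : V p) :
    ‖qf p a x‖ = max (max (‖x 0‖ ^ 2) (‖x 1‖ ^ 2))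
      ((p : ℝ)⁻¹ * max (‖x 2‖ ^ 2) (‖x 3‖ ^ 2)) := by
  rw [← ha.norm_sq_sub_mul_sq, ← ha.norm_sq_sub_mul_sq,
    show qf p a x = (x 0 ^ 2 - a * x 1 ^ 2) + (-(p : ℚ_[p])) * (x 2 ^ 2 - a * x 3 ^ 2) by
      unfold qf; ring]
  by_cases h0 : x 2 = 0 ∧ x 3 = 0
  · simp [h0.1, h0.2]
  rw [Padic.add_eq_max_of_ne, norm_mul, norm_neg, Padic.norm_p]
  rw [norm_mul, norm_neg, Padic.norm_p, ha.norm_sq_sub_mul_sq, ha.norm_sq_sub_mul_sq]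
  intro h
  obtain ⟨u, hu⟩ : ∃ u : ℚ_[p], max (‖x 0‖ ^ 2) (‖x 1‖ ^ 2) = ‖u‖ ^ 2 := by
    rcases max_choice (‖x 0‖ ^ 2) (‖x 1‖ ^ 2) with h | h <;> exact ⟨_, h⟩
  rcases max_choice (‖x 2‖ ^ 2) (‖x 3‖ ^ 2) with h' | h' <;> rw [h', hu] at h <;>
    have := eq_zero_of_norm_sq_eq_inv_mul_norm_sq h <;> refine h0 ?_ <;>
    rw [this] at h' <;> simp at h' <;>
    simp [this, h']

/-- The weights for which `‖qf p a x‖ = max_i weight p i * ‖x i‖ ^ 2`. -/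
def weight (p : ℕ) : Fin 4 → ℝ := ![1, 1, (p : ℝ)⁻¹, (p : ℝ)⁻¹]

theorem weight_pos (i : Fin 4) : 0 < weight p i := by
  have : 0 < (p : ℝ) := by exact_mod_cast (Fact.out : p.Prime).pos
  fin_cases i <;> simp [weight, this]

theorem weight_mul_weight_rev (q : ℕ) (i : Fin 4) :
    weight q i * weight q i.rev = (q : ℝ)⁻¹ := by
  fin_cases i <;> simp [weight, Fin.rev]

theorem IsQNR.norm_qf_le_iff {a : ℤ} (ha : IsQNR p a) {x : V p} {r : ℝ} :
    ‖qf p a x‖ ≤ r ↔ ∀ i, weight p i * ‖x i‖ ^ 2 ≤ r := by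
  have : 0 < (p : ℝ) := by exact_mod_cast (Fact.out : p.Prime).pos
  rw [ha.norm_qf, mul_max_of_nonneg _ _ (by positivity)]
  simp [Fin.forall_fin_succ, weight, and_assoc]

theorem IsQNR.exists_norm_qf_eq {a : ℤ} (ha : IsQNR p a) (x : V p) :
    ∃ i, ‖qf p a x‖ = weight p i * ‖x i‖ ^ 2 := by
  by_contra! h
  have h2 : ∀ i, weight p i * ‖x i‖ ^ 2 < ‖qf p a x‖ := fun i =>
    (ha.norm_qf_le_iff.1 le_rfl i).lt_of_ne (h i).symm
  have : 0 < (p : ℝ) := by exact_mod_cast (Fact.out : p.Prime).pos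
  have h0 := h2 0
  have h1 := h2 1
  have h3 := h2 2
  have h4 := h2 3
  rw [ha.norm_qf, mul_max_of_nonneg _ _ (by positivity)] at h0 h1 h3 h4
  simp [weight] at h0 h1 h3 h4
  grind

theorem qfc_eq_qf_rev (a : ℤ) (x : V p) : qfc p a x = qf p a (x ∘ Fin.rev) := by
  simp [qf, qfc, Fin.rev]
  ring

theorem IsQNR.norm_qf_add_le {a : ℤ} (ha : IsQNR p a) {x y : V p} {r : ℝ}
    (hx : ‖qf p a x‖ ≤ r) (hy : ‖qf p a y‖ ≤ r) : ‖qf p a (x + y)‖ ≤ r := by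
  rw [ha.norm_qf_le_iff] at *
  intro i
  have hw := (weight_pos (p := p) i).le
  rcases le_max_iff.1 (Padic.nonarchimedean (x i) (y i)) with h | h
  · exact le_trans (by rw [Pi.add_apply]; gcongr) (hx i)
  · exact le_trans (by rw [Pi.add_apply]; gcongr) (hy i)

theorem qf_neg (a : ℤ) (x : V p) : qf p a (-x) = qf p a x := by simp [qf]

theorem continuous_qf (a : ℤ) : Continuous (qf p a) := by unfold qf; fun_prop

theorem IsQNR.norm_apply_mul_le_one {a : ℤ} (ha : IsQNR p a) {ξ x : V p}
    (h : ‖qf p a ξ‖ * ‖qfc p a x‖ ≤ 1) (i : Fin 4) : ‖ξ i * x i‖ ≤ 1 := by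
  have hp : 1 < (p : ℝ) := by exact_mod_cast (Fact.out : p.Prime).one_lt
  rw [qfc_eq_qf_rev] at h
  have h1 := ha.norm_qf_le_iff.1 (le_refl ‖qf p a ξ‖) i
  have h2 := ha.norm_qf_le_iff.1 (le_refl ‖qf p a (x ∘ Fin.rev)‖) i.rev
  rw [Function.comp_apply, Fin.rev_rev] at h2
  have hw := (weight_pos (p := p) i).le
  have hw' := (weight_pos (p := p) i.rev).le
  have h3 := (mul_le_mul h1 h2 (by positivity) (by positivity)).trans h
  have h4 : (p : ℝ)⁻¹ * ‖ξ i * x i‖ ^ 2 ≤ 1 := by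
    rw [← weight_mul_weight_rev p i, norm_mul]; exact h3.trans_eq' (by ring)
  have h5 : ‖ξ i * x i‖ ^ 2 ≤ p := by rwa [inv_mul_le_iff₀ (by positivity), mul_one] at h4
  have h6 : ‖ξ i * x i‖ < (p : ℝ) ^ (0 + 1 : ℤ) := by
    rw [zero_add, zpow_one]
    nlinarith [norm_nonneg (ξ i * x i)]
  simpa using (Padic.norm_le_pow_iff_norm_lt_pow_add_one _ 0).2 h6

theorem IsQNR.norm_sum_mul_le_one {a : ℤ} (ha : IsQNR p a) {ξ x : V p}
    (h : ‖qf p a ξ‖ * ‖qfc p a x‖ ≤ 1) : ‖∑ i, ξ i * x i‖ ≤ 1 :=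
  IsUltrametricDist.norm_sum_le_of_forall_le_of_nonneg zero_le_one
    fun i _ => ha.norm_apply_mul_le_one h i

theorem IsQNR.exists_sum_mul_eq_inv_p {a : ℤ} (ha : IsQNR p a) {x : V p} (hx : qfc p a x ≠ 0) :
    ∃ ξ : V p, ‖qf p a ξ‖ * ‖qfc p a x‖ = p ∧ ∑ i, ξ i * x i = (p : ℚ_[p])⁻¹ := by
  have hp : 0 < (p : ℝ) := by exact_mod_cast (Fact.out : p.Prime).pos
  rw [qfc_eq_qf_rev] at *
  obtain ⟨j, hj⟩ := ha.exists_norm_qf_eq (x ∘ Fin.rev)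
  obtain ⟨i, rfl⟩ := Fin.rev_surjective j
  rw [Function.comp_apply, Fin.rev_rev] at hj
  have hxi : x i ≠ 0 := by
    rintro h
    rw [h] at hj
    simp at hj
    exact hx hj
  refine ⟨Pi.single i ((p : ℚ_[p])⁻¹ / x i), ?_, ?_⟩
  · have hq : ‖qf p a (Pi.single i ((p : ℚ_[p])⁻¹ / x i))‖ =
        weight p i * ‖(p : ℚ_[p])⁻¹ / x i‖ ^ 2 := by
      apply le_antisymm
      · rw [ha.norm_qf_le_iff]
        intro k
        have := (weight_pos (p := p) i).le
        rcases eq_or_ne k i with rfl | hk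
        · simp
        · simp [hk]; positivity
      · simpa using ha.norm_qf_le_iff.1 (le_refl ‖qf p a (Pi.single i ((p : ℚ_[p])⁻¹ / x i))‖) i
    have hxi' : ‖x i‖ ≠ 0 := norm_ne_zero_iff.2 hxi
    rw [hq, hj, norm_div, norm_inv, Padic.norm_p, inv_inv,
      show weight p i * (p / ‖x i‖) ^ 2 * (weight p i.rev * ‖x i‖ ^ 2) =
        (weight p i * weight p i.rev) * p ^ 2 by field_simp, weight_mul_weight_rev]
    field_simp
  · rw [Finset.sum_eq_single i]
    · simp [hxi]
    · intro k _ hk; simp [hk]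
    · simp

/-- The ball `{ξ | ‖qf p a ξ‖ ≤ pⁿ}`. -/
def qball (p : ℕ) [Fact p.Prime] (a n : ℤ) : Set (V p) := {ξ | ‖qf p a ξ‖ ≤ (p : ℝ) ^ n}

theorem isClosed_qball (a n : ℤ) : IsClosed (qball p a n) :=
  isClosed_le (continuous_qf a).norm continuous_const

theorem measurableSet_qball (a n : ℤ) : MeasurableSet (qball p a n) :=
  (isClosed_qball a n).measurableSet

theorem qball_mono (a : ℤ) : Monotone (qball p a) := by
  intro m n hmn ξ hξ
  have hp : 1 ≤ (p : ℝ) := by exact_mod_cast (Fact.out : p.Prime).one_lt.le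
  exact le_trans hξ (zpow_le_zpow_right₀ hp hmn)

theorem IsQNR.add_mem_qball_iff {a n : ℤ} (ha : IsQNR p a) {x y : V p} (hx : x ∈ qball p a n) :
    x + y ∈ qball p a n ↔ y ∈ qball p a n := by
  refine ⟨fun h => ?_, ha.norm_qf_add_le hx⟩
  have hx' : ‖qf p a (-x)‖ ≤ (p : ℝ) ^ n := by rw [qf_neg]; exact hx
  have h2 := ha.norm_qf_add_le hx' h
  rwa [neg_add_cancel_left] at h2

theorem norm_lt_one_iff_sq_le {y : ℚ_[p]} : ‖y‖ < 1 ↔ ‖y‖ ^ 2 ≤ (p : ℝ)⁻¹ := by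
  have hp : 1 < (p : ℝ) := by exact_mod_cast (Fact.out : p.Prime).one_lt
  have hp' : (p : ℝ)⁻¹ < 1 := inv_lt_one_of_one_lt₀ hp
  constructor
  · intro h
    have := (Padic.norm_lt_pow_iff_norm_le_pow_sub_one y 0).1 (by simpa using h)
    rw [zero_sub, zpow_neg_one] at this
    nlinarith [norm_nonneg y]
  · intro h
    nlinarith [norm_nonneg y]

theorem norm_le_one_iff_inv_mul_sq_le {y : ℚ_[p]} : ‖y‖ ≤ 1 ↔ (p : ℝ)⁻¹ * ‖y‖ ^ 2 ≤ 1 := by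
  have hp : 1 < (p : ℝ) := by exact_mod_cast (Fact.out : p.Prime).one_lt
  rw [inv_mul_le_iff₀ (by positivity), mul_one]
  constructor
  · intro h
    nlinarith [norm_nonneg y]
  · intro h
    have h6 : ‖y‖ < (p : ℝ) ^ (0 + 1 : ℤ) := by
      rw [zero_add, zpow_one]
      nlinarith [norm_nonneg y]
    simpa using (Padic.norm_le_pow_iff_norm_lt_pow_add_one _ 0).2 h6

theorem IsQNR.qball_zero {a : ℤ} (ha : IsQNR p a) : qball p a 0 = {x : V p | ‖x‖ ≤ 1} := by
  ext x
  rw [qball, mem_ofPred_eq, mem_ofPred_eq, ha.norm_qf_le_iff, pi_norm_le_iff_of_nonneg zero_le_one]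
  simp [Fin.forall_fin_succ, weight, norm_le_one_iff_inv_mul_sq_le (y := x 2),
    norm_le_one_iff_inv_mul_sq_le (y := x 3)]

theorem IsQNR.mem_qball_neg_one {a : ℤ} (ha : IsQNR p a) {x : V p} :
    x ∈ qball p a (-1) ↔ ‖x 0‖ < 1 ∧ ‖x 1‖ < 1 ∧ ‖x 2‖ ≤ 1 ∧ ‖x 3‖ ≤ 1 := by
  have hp : 0 < (p : ℝ) := by exact_mod_cast (Fact.out : p.Prime).pos
  rw [qball, mem_ofPred_eq, ha.norm_qf_le_iff]
  simp [Fin.forall_fin_succ, weight, norm_lt_one_iff_sq_le, hp]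

/-- The vector `(i, j, 0, 0)`. -/
def digitVec (p : ℕ) [Fact p.Prime] (d : Fin p × Fin p) : V p := ![(d.1 : ℕ), (d.2 : ℕ), 0, 0]

theorem eq_of_norm_sub_natCast_lt_one {y : ℚ_[p]} {i j : Fin p} (hi : ‖-((i : ℕ) : ℚ_[p]) + y‖ < 1)
    (hj : ‖-((j : ℕ) : ℚ_[p]) + y‖ < 1) : i = j := by
  have h : ‖(((i : ℕ) - (j : ℕ) : ℤ) : ℚ_[p])‖ < 1 := by
    have := Padic.nonarchimedean (-((j : ℕ) : ℚ_[p]) + y) (-(-((i : ℕ) : ℚ_[p]) + y))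
    rw [norm_neg] at this
    refine lt_of_eq_of_lt ?_ (this.trans_lt (max_lt hj hi))
    congr 1
    push_cast
    ring
  rw [Padic.norm_intCast_lt_one_iff] at h
  have := Int.eq_zero_of_abs_lt_dvd h (by rw [abs_lt]; omega)
  omega

theorem exists_norm_sub_natCast_lt_one {y : ℚ_[p]} (hy : ‖y‖ ≤ 1) :
    ∃ i : Fin p, ‖-((i : ℕ) : ℚ_[p]) + y‖ < 1 := by
  have h := PadicInt.norm_sub_zmodRepr_lt_one (⟨y, hy⟩ : ℤ_[p])
  refine ⟨⟨_, PadicInt.zmodRepr_lt_p ⟨y, hy⟩⟩, ?_⟩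
  rw [PadicInt.norm_def] at h
  rwa [neg_add_eq_sub]

theorem IsQNR.qball_zero_eq_iUnion {a : ℤ} (ha : IsQNR p a) :
    qball p a 0 = ⋃ d : Fin p × Fin p, (fun ξ => -digitVec p d + ξ) ⁻¹' qball p a (-1) := by
  ext x
  simp only [mem_iUnion, mem_preimage]
  constructor
  · intro hx
    rw [ha.qball_zero, mem_ofPred_eq, pi_norm_le_iff_of_nonneg zero_le_one] at hx
    obtain ⟨i, hi⟩ := exists_norm_sub_natCast_lt_one (hx 0)
    obtain ⟨j, hj⟩ := exists_norm_sub_natCast_lt_one (hx 1)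
    refine ⟨(i, j), ?_⟩
    rw [ha.mem_qball_neg_one]
    simpa [digitVec] using ⟨hi, hj, hx 2, hx 3⟩
  · rintro ⟨d, hd⟩
    have h1 := qball_mono a (by norm_num : (-1 : ℤ) ≤ 0) hd
    rw [ha.add_mem_qball_iff] at h1
    · exact h1
    · rw [ha.qball_zero, mem_ofPred_eq, pi_norm_le_iff_of_nonneg zero_le_one]
      have : ∀ n : ℕ, ‖(n : ℚ_[p])‖ ≤ 1 := fun n => by
        exact_mod_cast Padic.norm_int_le_one (p := p) n
      simp [Fin.forall_fin_succ, digitVec, this]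

theorem IsQNR.measure_qball_zero {a : ℤ} (ha : IsQNR p a) (μ : Measure (V p))
    [μ.IsAddHaarMeasure] : μ (qball p a 0) = (p : ENNReal) ^ 2 * μ (qball p a (-1)) := by
  rw [ha.qball_zero_eq_iUnion, measure_iUnion, tsum_fintype]
  · simp only [measure_preimage_add]
    simp [sq]
  · intro d e hde
    refine Set.disjoint_left.2 fun x hd he => hde ?_
    rw [mem_preimage, ha.mem_qball_neg_one] at hd he
    simp only [digitVec, Pi.add_apply, Pi.neg_apply, Matrix.cons_val_zero,
      Matrix.cons_val_one] at hd he
    exact Prod.ext (eq_of_norm_sub_natCast_lt_one hd.1 he.1)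
      (eq_of_norm_sub_natCast_lt_one hd.2.1 he.2.1)
  · intro d
    exact (measurableSet_qball a _).preimage (by fun_prop)

/-- A linear similarity of `qf` with multiplier of norm `p⁻¹`. -/
def simil (p : ℕ) [Fact p.Prime] : V p ≃L[ℚ_[p]] V p where
  toFun x := ![p * x 2, p * x 3, x 0, x 1]
  invFun x := ![x 2, x 3, (p : ℚ_[p])⁻¹ * x 0, (p : ℚ_[p])⁻¹ * x 1]
  map_add' x y := by ext i; fin_cases i <;> simp [mul_add]
  map_smul' c x := by ext i; fin_cases i <;> simp [mul_left_comm]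
  left_inv x := by
    have := (Fact.out : p.Prime).ne_zero
    ext i; fin_cases i <;> simp [this]
  right_inv x := by
    have := (Fact.out : p.Prime).ne_zero
    ext i; fin_cases i <;> simp [this]
  continuous_toFun := by
    refine continuous_pi fun i => ?_
    fin_cases i <;> simp <;> fun_prop
  continuous_invFun := by
    refine continuous_pi fun i => ?_
    fin_cases i <;> simp <;> fun_prop

theorem simil_preimage_qball (a n : ℤ) : simil p ⁻¹' qball p a n = qball p a (n + 1) := by
  have hp : 0 < (p : ℝ) := by exact_mod_cast (Fact.out : p.Prime).pos
  ext x
  have : qf p a (simil p x) = -(p : ℚ_[p]) * qf p a x := by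
    simp [simil, qf]
    ring
  rw [mem_preimage, qball, qball, mem_ofPred_eq, mem_ofPred_eq, this, norm_mul, norm_neg,
    Padic.norm_p, inv_mul_le_iff₀ hp, zpow_add_one₀ hp.ne', mul_comm (p : ℝ)]

theorem IsQNR.measure_qball {a : ℤ} (ha : IsQNR p a) (μ : Measure (V p))
    [μ.IsAddHaarMeasure] (hμ : μ {x : V p | ‖x‖ ≤ 1} = 1) (n : ℤ) :
    μ (qball p a n) = ENNReal.ofReal ((p : ℝ) ^ (2 * n)) := by
  have hp : 0 < (p : ℝ) := by exact_mod_cast (Fact.out : p.Prime).pos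
  have hpe : (p : ENNReal) ≠ 0 := by exact_mod_cast (Fact.out : p.Prime).ne_zero
  rw [← ha.qball_zero] at hμ
  have := (simil p).isAddHaarMeasure_map μ
  obtain ⟨c, hc⟩ : ∃ c : NNReal, μ.map (simil p) = c • μ :=
    ⟨_, Measure.isAddLeftInvariant_eq_smul _ _⟩
  have step : ∀ n, μ (qball p a (n + 1)) = c * μ (qball p a n) := by
    intro n
    rw [← simil_preimage_qball, ← Measure.map_apply (simil p).continuous.measurable
      (measurableSet_qball a n), hc,
      Measure.smul_apply, ENNReal.smul_def, smul_eq_mul]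
  have h0 := ha.measure_qball_zero μ
  have hneg : μ (qball p a (-1)) ≠ 0 := by
    intro h
    rw [h, hμ, mul_zero] at h0
    exact one_ne_zero h0
  have hneg' : μ (qball p a (-1)) ≠ ⊤ :=
    ((measure_mono (qball_mono a (by norm_num))).trans_lt
      (hμ.trans_lt ENNReal.one_lt_top)).ne
  have hcp : (c : ENNReal) = (p : ENNReal) ^ 2 := by
    have h1 := step (-1)
    rw [neg_add_cancel, h0] at h1
    exact ((ENNReal.mul_left_inj hneg hneg').1 h1).symm
  have hc' : (c : ENNReal) = ENNReal.ofReal ((p : ℝ) ^ 2) := by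
    rw [hcp, ENNReal.ofReal_pow hp.le, ENNReal.ofReal_natCast]
  rw [hc'] at step
  induction n using Int.induction_on with
  | zero => simpa using hμ
  | succ n ih =>
    rw [step, ih, ← ENNReal.ofReal_mul (by positivity), mul_add, zpow_add₀ hp.ne', mul_comm]
    norm_cast
  | pred n ih =>
    have h2 := step (-n - 1)
    rw [sub_add_cancel, ih] at h2
    rw [← ENNReal.mul_right_inj (a := ENNReal.ofReal ((p : ℝ) ^ 2)) (by positivity) (by simp), ← h2,
      ← ENNReal.ofReal_mul (by positivity), ← zpow_natCast, ← zpow_add₀ hp.ne']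
    congr 2
    push_cast
    ring

theorem IsQNR.measureReal_qball {a : ℤ} (ha : IsQNR p a) (μ : Measure (V p))
    [μ.IsAddHaarMeasure] (hμ : μ {x : V p | ‖x‖ ≤ 1} = 1) (n : ℤ) :
    μ.real (qball p a n) = (p : ℝ) ^ (2 * n) := by
  rw [measureReal_def, ha.measure_qball μ hμ, ENNReal.toReal_ofReal (by positivity)]

theorem IsStdChar.continuous_sum {χ : ℚ_[p] → ℂ} (hχ : IsStdChar p χ) (x : V p) :
    Continuous fun ξ : V p => χ (∑ i, ξ i * x i) := by
  have := hχ.1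
  fun_prop

theorem IsStdChar.integrableOn {χ : ℚ_[p] → ℂ} (hχ : IsStdChar p χ) (x : V p)
    {μ : Measure (V p)} {s : Set (V p)} (hs : μ s ≠ ⊤) :
    IntegrableOn (fun ξ : V p => χ (∑ i, ξ i * x i)) s μ := by
  have : IsFiniteMeasure (μ.restrict s) := isFiniteMeasure_restrict.2 hs
  exact Integrable.of_bound (hχ.continuous_sum x).aestronglyMeasurable 1
    (ae_of_all _ fun ξ => (hχ.norm_apply _).le)

theorem IsQNR.setIntegral_qball {a : ℤ} (ha : IsQNR p a) (μ : Measure (V p))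
    [μ.IsAddHaarMeasure] (hμ : μ {x : V p | ‖x‖ ≤ 1} = 1) {χ : ℚ_[p] → ℂ} (hχ : IsStdChar p χ)
    {x : V p} {m : ℤ} (hx : ‖qfc p a x‖ = (p : ℝ) ^ m) (n : ℤ) :
    ∫ ξ in qball p a n, χ (∑ i, ξ i * x i) ∂μ = if n ≤ -m then (p : ℂ) ^ (2 * n) else 0 := by
  have hp1 : 1 < (p : ℝ) := by exact_mod_cast (Fact.out : p.Prime).one_lt
  have hp : 0 < (p : ℝ) := by positivity
  split_ifs with h
  · have h1 : EqOn (fun ξ : V p => χ (∑ i, ξ i * x i)) (fun _ => 1) (qball p a n) := by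
      intro ξ hξ
      refine hχ.apply_of_norm_le_one (ha.norm_sum_mul_le_one ?_)
      rw [hx]
      calc _ ≤ (p : ℝ) ^ n * (p : ℝ) ^ m := by gcongr; exact hξ
        _ = (p : ℝ) ^ (n + m) := (zpow_add₀ hp.ne' _ _).symm
        _ ≤ 1 := zpow_le_one_of_nonpos₀ hp1.le (by omega)
    rw [setIntegral_congr_fun (measurableSet_qball a n) h1, setIntegral_const,
      ha.measureReal_qball μ hμ]
    simp
  · have hx0 : qfc p a x ≠ 0 := by
      rw [← norm_ne_zero_iff, hx]; positivity
    obtain ⟨η, hη, hηx⟩ := ha.exists_sum_mul_eq_inv_p hx0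
    have hmem : η ∈ qball p a n := by
      rw [hx] at hη
      have : ‖qf p a η‖ = (p : ℝ) ^ (1 - m) := by
        rw [zpow_sub₀ hp.ne', zpow_one, eq_div_iff (by positivity), hη]
      rw [qball, mem_ofPred_eq, this]
      exact zpow_le_zpow_right₀ hp1.le (by omega)
    have key : ∫ ξ in qball p a n, χ (∑ i, ξ i * x i) ∂μ =
        χ (p : ℚ_[p])⁻¹ * ∫ ξ in qball p a n, χ (∑ i, ξ i * x i) ∂μ := by
      rw [← integral_indicator (measurableSet_qball a n), ← integral_const_mul,
        ← integral_add_left_eq_self _ η]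
      congr 1
      ext ξ
      by_cases hξ : ξ ∈ qball p a n
      · rw [indicator_of_mem ((ha.add_mem_qball_iff hmem).2 hξ), indicator_of_mem hξ]
        simp only [Pi.add_apply, add_mul, Finset.sum_add_distrib, hηx, hχ.apply_add]
      · rw [indicator_of_notMem (mt (ha.add_mem_qball_iff hmem).1 hξ), indicator_of_notMem hξ,
          mul_zero]
    by_contra h0
    exact hχ.apply_inv_p_ne_one (mul_right_cancel₀ h0 (key.symm.trans (one_mul _).symm))

theorem mem_qball_diff {a n : ℤ} {ξ : V p} :
    ξ ∈ qball p a n \ qball p a (n - 1) ↔ ‖qf p a ξ‖ = (p : ℝ) ^ n := by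
  have hp1 : 1 < (p : ℝ) := by exact_mod_cast (Fact.out : p.Prime).one_lt
  rw [Set.mem_sdiff, qball, qball, mem_ofPred_eq, mem_ofPred_eq,
    ← Padic.norm_lt_pow_iff_norm_le_pow_sub_one, not_lt]
  exact ⟨fun h => le_antisymm h.1 h.2, fun h => ⟨h.le, h.ge⟩⟩

theorem IsQNR.measureReal_qball_diff {a : ℤ} (ha : IsQNR p a) (μ : Measure (V p))
    [μ.IsAddHaarMeasure] (hμ : μ {x : V p | ‖x‖ ≤ 1} = 1) (n : ℤ) :
    μ.real (qball p a n \ qball p a (n - 1)) = (p : ℝ) ^ (2 * n) * (1 - ((p : ℝ)⁻¹) ^ 2) := by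
  have hp : 0 < (p : ℝ) := by exact_mod_cast (Fact.out : p.Prime).pos
  rw [measureReal_sdiff (qball_mono a (by omega)) (measurableSet_qball a _)
    (by rw [ha.measure_qball μ hμ]; simp),
    ha.measureReal_qball μ hμ, ha.measureReal_qball μ hμ, mul_sub, mul_sub, zpow_sub₀ hp.ne']
  field_simp
  norm_num
  ring

theorem IsQNR.setIntegral_qball_diff {a : ℤ} (ha : IsQNR p a) (μ : Measure (V p))
    [μ.IsAddHaarMeasure] (hμ : μ {x : V p | ‖x‖ ≤ 1} = 1) {χ : ℚ_[p] → ℂ} (hχ : IsStdChar p χ)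
    {x : V p} {m : ℤ} (hx : ‖qfc p a x‖ = (p : ℝ) ^ m) (j : ℕ) :
    ∫ ξ in qball p a (1 - m + j) \ qball p a (1 - m + j - 1), (χ (∑ i, ξ i * x i) - 1) ∂μ =
      -((p : ℂ) ^ (2 * (1 - m + j)) *
        ((1 - ((p : ℂ)⁻¹) ^ 2) + if j = 0 then (p : ℂ)⁻¹ ^ 2 else 0)) := by
  have hp : (p : ℂ) ≠ 0 := by exact_mod_cast (Fact.out : p.Prime).ne_zero
  have hfin : ∀ n, μ (qball p a n) ≠ ⊤ := fun n => by rw [ha.measure_qball μ hμ]; simp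
  have hfin' : ∀ n, μ (qball p a n \ qball p a (n - 1)) ≠ ⊤ := fun n =>
    measure_ne_top_of_subset sdiff_subset (hfin n)
  rw [integral_sub (hχ.integrableOn x (hfin' _)) (integrableOn_const (hfin' _)),
    setIntegral_sdiff (measurableSet_qball a _) (hχ.integrableOn x (hfin _)) (qball_mono a (by omega)),
    setIntegral_const, ha.measureReal_qball_diff μ hμ, ha.setIntegral_qball μ hμ hχ hx,
    ha.setIntegral_qball μ hμ hχ hx, if_neg (by omega)]
  simp only [Complex.real_smul]
  push_cast
  rcases eq_or_ne j 0 with rfl | hj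
  · rw [if_pos (by simp), if_pos rfl, mul_sub 2, zpow_sub₀ hp]
    field_simp
    norm_num
    ring
  · rw [if_neg (by omega), if_neg hj]
    ring

theorem IsQNR.eq_zero_of_qfc_eq_zero {a : ℤ} (ha : IsQNR p a) {x : V p} (hx : qfc p a x = 0) :
    x = 0 := by
  rw [qfc_eq_qf_rev] at hx
  have h := ha.norm_qf_le_iff.1 (norm_le_zero_iff.2 hx)
  ext i
  have hi := h i.rev
  rw [Function.comp_apply, Fin.rev_rev] at hi
  have := weight_pos (p := p) i.rev
  have h2 : ‖x i‖ ^ 2 ≤ 0 := by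
    by_contra! h3
    exact (mul_pos this h3).not_ge hi
  simpa using h2

theorem IsQNR.eq_one_of_not_mem {a : ℤ} (ha : IsQNR p a) {χ : ℚ_[p] → ℂ} (hχ : IsStdChar p χ)
    {x ξ : V p} {m : ℤ} (hx : ‖qfc p a x‖ = (p : ℝ) ^ m)
    (hξ : ξ ∉ ⋃ j : ℕ, qball p a (1 - m + j) \ qball p a (1 - m + j - 1)) :
    χ (∑ i, ξ i * x i) = 1 := by
  have hp1 : 1 < (p : ℝ) := by exact_mod_cast (Fact.out : p.Prime).one_lt
  refine hχ.apply_of_norm_le_one (ha.norm_sum_mul_le_one ?_)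
  rw [hx]
  rcases eq_or_ne (qf p a ξ) 0 with h0 | h0
  · simp [h0]
  have hn := Padic.norm_eq_zpow_neg_valuation h0
  set n := -(qf p a ξ).valuation
  rw [hn, ← zpow_add₀ (by positivity)]
  refine zpow_le_one_of_nonpos₀ hp1.le ?_
  by_contra! h
  refine hξ (mem_iUnion.2 ⟨(n - (1 - m)).toNat, ?_⟩)
  rw [Int.toNat_of_nonneg (by omega), add_sub_cancel, mem_qball_diff, hn]

theorem pairwise_disjoint_qball_diff (a k : ℤ) :
    Pairwise (Function.onFun Disjoint
      fun j : ℕ => qball p a (k + j) \ qball p a (k + j - 1)) := by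
  have hp1 : 1 < (p : ℝ) := by exact_mod_cast (Fact.out : p.Prime).one_lt
  intro i j hij
  refine Set.disjoint_left.2 fun ξ hi hj => hij ?_
  rw [mem_qball_diff] at hi hj
  have := zpow_right_injective₀ (by positivity) hp1.ne' (hi.symm.trans hj)
  simpa using this

theorem zpow_rpow_mul_zpow_two (α : ℝ) (k : ℤ) (j : ℕ) :
    ((p : ℝ) ^ (k + j)) ^ (-α - 2) * (p : ℝ) ^ (2 * (k + j)) =
      ((p : ℝ) ^ k) ^ (-α) * ((p : ℝ) ^ (-α)) ^ j := by
  have hp : 0 < (p : ℝ) := by exact_mod_cast (Fact.out : p.Prime).pos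
  simp only [← Real.rpow_intCast, ← Real.rpow_natCast, ← Real.rpow_mul hp.le, ← Real.rpow_add hp]
  congr 1
  push_cast
  ring

theorem hasSum_geometric_add_single {t : ℝ} (ht0 : 0 ≤ t) (ht1 : t < 1) (K s : ℝ) :
    HasSum (fun j : ℕ => -(K * t ^ j * ((1 - s) + if j = 0 then s else 0)))
      (-(K * ((1 - t * s) / (1 - t)))) := by
  have h1 := (hasSum_geometric_of_lt_one ht0 ht1).mul_left (-(K * (1 - s)))
  have h2 := (hasSum_ite_eq 0 (-(K * s)) : HasSum (fun j : ℕ => _) _)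
  have h3 : 1 - t ≠ 0 := by linarith
  have h4 : -(K * ((1 - t * s) / (1 - t))) = -(K * (1 - s)) * (1 - t)⁻¹ + -(K * s) := by
    field_simp
    ring
  rw [h4]
  refine Eq.subst (motive := fun f => HasSum f _) (funext fun j => ?_) (h1.add h2)
  split_ifs with hj
  · rw [hj]
    ring
  · ring

end

/-- for `α > 0` and every `x ∈ ℚ_p⁴`,
`|f°(x)|_p^α = ((1 − p^α)/(1 − p^{−α−2})) ∫ |f(ξ)|_p^{−α−2} (χ(ξ·x) − 1) d⁴ξ`,
the integral being absolutely convergent. -/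
theorem statement0
    (hp : p ≠ 2) (a : ℤ) (ha : IsQNR p a)
    (μ : Measure (V p)) [μ.IsAddHaarMeasure] (hμ : μ {x : V p | ‖x‖ ≤ 1} = 1)
    (χ : ℚ_[p] → ℂ) (hχ : IsStdChar p χ)
    (α : ℝ) (hα : 0 < α) (x : V p) :
    Integrable (fun ξ : V p =>
        ((‖qf p a ξ‖ ^ (-α - 2) : ℝ) : ℂ) * (χ (∑ i, ξ i * x i) - 1)) μ ∧
    ((‖qfc p a x‖ ^ α : ℝ) : ℂ) =
      (((1 - (p : ℝ) ^ α) / (1 - (p : ℝ) ^ (-α - 2)) : ℝ) : ℂ) *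
        ∫ ξ, ((‖qf p a ξ‖ ^ (-α - 2) : ℝ) : ℂ) * (χ (∑ i, ξ i * x i) - 1) ∂μ := by
  have hp1 : 1 < (p : ℝ) := by exact_mod_cast (Fact.out : p.Prime).one_lt
  have hp0 : 0 < (p : ℝ) := by positivity
  by_cases hx0 : qfc p a x = 0
  · have hχ0 : χ 0 = 1 := hχ.apply_of_norm_le_one (by simp)
    simp [ha.eq_zero_of_qfc_eq_zero hx0, hχ0, qfc, Real.zero_rpow hα.ne']
  have hx := Padic.norm_eq_zpow_neg_valuation hx0
  set m := -(qfc p a x).valuation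
  set F : V p → ℂ := fun ξ => ((‖qf p a ξ‖ ^ (-α - 2) : ℝ) : ℂ) * (χ (∑ i, ξ i * x i) - 1) with hF
  set S : ℕ → Set (V p) := fun j => qball p a (1 - m + j) \ qball p a (1 - m + j - 1) with hS
  set t : ℝ := (p : ℝ) ^ (-α) with ht
  set K : ℝ := ((p : ℝ) ^ (1 - m)) ^ (-α) with hK
  have ht0 : 0 < t := by positivity
  have ht1 : t < 1 := Real.rpow_lt_one_of_one_lt_of_neg hp1 (by linarith)
  have hSm : ∀ j, MeasurableSet (S j) := fun j =>
    (measurableSet_qball a _).diff (measurableSet_qball a _)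
  have hSfin : ∀ j, μ (S j) ≠ ⊤ := fun j =>
    measure_ne_top_of_subset sdiff_subset (by rw [ha.measure_qball μ hμ]; simp)
  have hFS : ∀ j : ℕ, EqOn F (fun ξ => ((((p : ℝ) ^ (1 - m + j)) ^ (-α - 2) : ℝ) : ℂ) *
      (χ (∑ i, ξ i * x i) - 1)) (S j) := by
    intro j ξ hξ
    simp only [hF, mem_qball_diff.1 hξ]
  have hFi : ∀ j, IntegrableOn F (S j) μ := by
    intro j
    rw [integrableOn_congr_fun (hFS j) (hSm j)]
    exact ((hχ.integrableOn x (hSfin j)).sub (integrableOn_const (hSfin j))).const_mul _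
  have hbound : ∀ j, ∫ ξ in S j, ‖F ξ‖ ∂μ ≤ 2 * K * t ^ j := by
    intro j
    have h1 : ∀ ξ ∈ S j, ‖F ξ‖ ≤ ((p : ℝ) ^ (1 - m + j)) ^ (-α - 2) * 2 := by
      intro ξ hξ
      rw [hFS j hξ, norm_mul, Complex.norm_real, Real.norm_of_nonneg (by positivity)]
      gcongr
      refine (norm_sub_le _ _).trans ?_
      rw [hχ.norm_apply, norm_one]
      norm_num
    calc ∫ ξ in S j, ‖F ξ‖ ∂μ
        ≤ ∫ ξ in S j, ((p : ℝ) ^ (1 - m + j)) ^ (-α - 2) * 2 ∂μ :=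
          setIntegral_mono_on (hFi j).norm (integrableOn_const (hSfin j)) (hSm j) h1
      _ = (((p : ℝ) ^ (1 - m + j)) ^ (-α - 2) * (p : ℝ) ^ (2 * (1 - m + j))) * 2 *
            (1 - ((p : ℝ)⁻¹) ^ 2) := by
          rw [setIntegral_const, ha.measureReal_qball_diff μ hμ, smul_eq_mul]
          ring
      _ = (2 * K * t ^ j) * (1 - ((p : ℝ)⁻¹) ^ 2) := by
          rw [zpow_rpow_mul_zpow_two]
          ring
      _ ≤ 2 * K * t ^ j := by
          refine mul_le_of_le_one_right (by positivity) ?_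
          have : 0 ≤ ((p : ℝ)⁻¹) ^ 2 := by positivity
          linarith
  have hint : IntegrableOn F (⋃ j, S j) μ := by
    refine integrableOn_iUnion_of_summable_integral_norm hFi ?_
    exact Summable.of_nonneg_of_le (fun j => integral_nonneg fun ξ => norm_nonneg _) hbound
      ((summable_geometric_of_lt_one ht0.le ht1).mul_left _)
  have hsupp : ∀ ξ, ξ ∉ ⋃ j, S j → F ξ = 0 := by
    intro ξ hξ
    simp only [hF, ha.eq_one_of_not_mem hχ hx hξ, sub_self, mul_zero]
  refine ⟨(integrableOn_iff_integrable_of_support_subset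
    (Function.support_subset_iff'.2 hsupp)).1 hint, ?_⟩
  have hsum := hasSum_integral_iUnion hSm (pairwise_disjoint_qball_diff a (1 - m)) hint
  rw [setIntegral_eq_integral_of_forall_compl_eq_zero hsupp] at hsum
  have hterm : ∀ j, ∫ ξ in S j, F ξ ∂μ =
      ((-(K * t ^ j * ((1 - (p : ℝ)⁻¹ ^ 2) + if j = 0 then (p : ℝ)⁻¹ ^ 2 else 0)) : ℝ) : ℂ) := by
    intro j
    rw [setIntegral_congr_fun (hSm j) (hFS j), integral_const_mul,
      ha.setIntegral_qball_diff μ hμ hχ hx, hK, ht, ← zpow_rpow_mul_zpow_two]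
    split_ifs <;> push_cast <;> ring
  simp only [hterm] at hsum
  rw [hsum.unique (Complex.hasSum_ofReal.2
    (hasSum_geometric_add_single ht0.le ht1 K ((p : ℝ)⁻¹ ^ 2))), ← Complex.ofReal_mul, hx]
  congr 1
  have h1 : (p : ℝ) ^ (-α - 2) = t * (p : ℝ)⁻¹ ^ 2 := by
    rw [Real.rpow_sub hp0, div_eq_mul_inv, Real.rpow_two, inv_pow]
  have h2 : (p : ℝ) ^ α = t⁻¹ := by rw [ht, Real.rpow_neg hp0.le, inv_inv]
  have h3 : K = ((p : ℝ) ^ m) ^ α * t := by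
    rw [hK, ht]
    simp only [← Real.rpow_intCast, ← Real.rpow_mul hp0.le, ← Real.rpow_add hp0]
    congr 1
    push_cast
    ring
  have h4 : 1 - t * (p : ℝ)⁻¹ ^ 2 ≠ 0 := by
    have : (p : ℝ)⁻¹ ^ 2 < 1 := pow_lt_one₀ (by positivity) (inv_lt_one_of_one_lt₀ hp1) two_ne_zero
    nlinarith
  have h5 : 1 - t ≠ 0 := by linarith
  rw [h1, h2, h3]
  generalize (p : ℝ)⁻¹ ^ 2 = s at h4
  field_simp
  ring

end PadicParabolic
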